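/- arXiv:2511.16918 — 2 statements merged into one kernel-verified Lean document; each statement's English description precedes it below -/
import Mathlib

section
/- Let G = (V,E) be a finite simple graph, let λ > 0, let i ∈ E be a pendant edge with endpoints u, v such that u has degree 1, and let τ = (B₊, B₋) be a vertex pinning with B₊ ∪ B₋ ⊆ V∖{u,v} such that both events {M satisfies τ and i ∈ M} and {M satisfies τ and i ∉ M} have positive probability under μ_{G,λ}. Then there exists a coupling π of the conditional distribution of M given (τ and i ∈ M) and the conditional distribution of M given (τ and i ∉ M) such that E_{(M,M') ∼ π}[ |(V(M) △ V(M'))∖{u}| ] ≤ 1. -/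
open scoped Classical

namespace SensMatching

variable {V : Type*} [Fintype V] [DecidableEq V]

/-- `M` is a matching of `G`: a finset of edges of `G`, no two of which share an endpoint. -/
def IsMatchingSet (G : SimpleGraph V) (M : Finset (Sym2 V)) : Prop :=
  (∀ e ∈ M, e ∈ G.edgeSet) ∧
    ∀ e ∈ M, ∀ f ∈ M, e ≠ f → ∀ v : V, v ∈ e → v ∉ f

/-- The finset of all matchings of `G`. -/
noncomputable def matchings (G : SimpleGraph V) : Finset (Finset (Sym2 V)) :=
  Finset.univ.filter fun M => IsMatchingSet G M

/-- `ν(G)`: the maximum size of a matching of `G`. -/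
noncomputable def nu (G : SimpleGraph V) : ℕ :=
  (matchings G).sup Finset.card

/-- `m_k(G)`: the number of matchings of size `k` in `G`. -/
noncomputable def numMatchings (G : SimpleGraph V) (k : ℕ) : ℕ :=
  ((matchings G).filter fun M => M.card = k).card

/-- The degree of a vertex `v` in `G`. -/
noncomputable def degr (G : SimpleGraph V) (v : V) : ℕ :=
  (Finset.univ.filter fun w => G.Adj v w).card

/-- The finset of edges of `G`. -/
noncomputable def edges (G : SimpleGraph V) : Finset (Sym2 V) :=
  Finset.univ.filter fun e => e ∈ G.edgeSet

/-- The partition function `Z_G(λ) = Σ_{M matching} λ^{|M|}`. -/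
noncomputable def partitionFn (G : SimpleGraph V) (lam : ℝ) : ℝ :=
  ∑ M ∈ matchings G, lam ^ M.card

/-- The probability, under the Gibbs distribution `μ_{G,λ}`, of the event `p`. -/
noncomputable def gibbsProb (G : SimpleGraph V) (lam : ℝ) (p : Finset (Sym2 V) → Prop) : ℝ :=
  (∑ M ∈ (matchings G).filter p, lam ^ M.card) / partitionFn G lam

/-- The law of `f M`, where `M` follows the Gibbs distribution `μ_{G,λ}` conditioned
on the event `p`. -/
noncomputable def condDistMap (G : SimpleGraph V) (lam : ℝ) (p : Finset (Sym2 V) → Prop)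
    (f : Finset (Sym2 V) → Finset (Sym2 V)) (N : Finset (Sym2 V)) : ℝ :=
  (∑ M ∈ ((matchings G).filter p).filter fun M => f M = N, lam ^ M.card) /
    ∑ M ∈ (matchings G).filter p, lam ^ M.card

/-- The Gibbs distribution `μ_{G,λ}` conditioned on the event `p`. -/
noncomputable def condDist (G : SimpleGraph V) (lam : ℝ) (p : Finset (Sym2 V) → Prop) :
    Finset (Sym2 V) → ℝ :=
  condDistMap G lam p id

/-- The Gibbs distribution `μ_{G,λ}` over matchings of `G`. -/
noncomputable def gibbsDist (G : SimpleGraph V) (lam : ℝ) : Finset (Sym2 V) → ℝ :=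
  condDist G lam fun _ => True

/-- `V(M)`: the set of vertices covered by the edge set `M`. -/
noncomputable def coveredVerts (M : Finset (Sym2 V)) : Finset V :=
  Finset.univ.filter fun v => ∃ e ∈ M, v ∈ e

/-- `N(i)`: the set of edges of `G` sharing an endpoint with `i`, excluding `i` itself. -/
def edgeNbhd (G : SimpleGraph V) (i : Sym2 V) : Set (Sym2 V) :=
  {e | e ∈ G.edgeSet ∧ e ≠ i ∧ ∃ v : V, v ∈ e ∧ v ∈ i}

/-- `π` is a coupling of the distributions `μ` and `μ'`. -/
def IsCoupling {α : Type*} [Fintype α] (π : α × α → ℝ) (μ μ' : α → ℝ) : Prop :=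
  (∀ q, 0 ≤ π q) ∧ (∀ a, ∑ b, π (a, b) = μ a) ∧ ∀ b, ∑ a, π (a, b) = μ' b

/-- The edge-Hamming distance `|M △ M'|`. -/
noncomputable def edist (M M' : Finset (Sym2 V)) : ℕ :=
  ((M \ M') ∪ (M' \ M)).card

/-- The vertex-Hamming distance `|V(M) △ V(M')|`. -/
noncomputable def vdist (M M' : Finset (Sym2 V)) : ℕ :=
  ((coveredVerts M \ coveredVerts M') ∪ (coveredVerts M' \ coveredVerts M)).card

/-- The vertex-Hamming distance ignoring the vertex `u`: `|(V(M) △ V(M')) \ {u}|`. -/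
noncomputable def vdistErase (u : V) (M M' : Finset (Sym2 V)) : ℕ :=
  (((coveredVerts M \ coveredVerts M') ∪ (coveredVerts M' \ coveredVerts M)).erase u).card

/-- `M` satisfies the vertex pinning `(Bp, Bm)`: every vertex of `Bp` is covered by `M`
and no vertex of `Bm` is covered by `M`. -/
def satisfiesPinning (M : Finset (Sym2 V)) (Bp Bm : Finset V) : Prop :=
  (∀ w ∈ Bp, w ∈ coveredVerts M) ∧ ∀ w ∈ Bm, w ∉ coveredVerts M

/-- The Wasserstein distance between `μ` and `μ'` with respect to the metric `d`:
the infimum over couplings of the expected distance. -/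
noncomputable def wass {α : Type*} [Fintype α] (d : α → α → ℝ) (μ μ' : α → ℝ) : ℝ :=
  sInf {c : ℝ | ∃ π : α × α → ℝ, IsCoupling π μ μ' ∧ c = ∑ q : α × α, π q * d q.1 q.2}

section Coupling

/-- A weight-preserving involution exchanging `A ×ˢ B` and `B ×ˢ A` yields a coupling of the
normalised weights on `A` and `B`, supported on the pairs `(q.1, (f q).1)`. -/
theorem exists_coupling_of_involutive {α : Type*} [Fintype α] [DecidableEq α]
    (A B : Finset α) (w : α → ℝ) (hw : ∀ a, 0 ≤ w a)
    (hA : 0 < ∑ a ∈ A, w a) (hB : 0 < ∑ b ∈ B, w b)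
    (f : α × α → α × α) (hf : Function.Involutive f)
    (hAB : ∀ q ∈ A ×ˢ B, f q ∈ B ×ˢ A) (hBA : ∀ q ∈ B ×ˢ A, f q ∈ A ×ˢ B)
    (hfw : ∀ q, w (f q).1 * w (f q).2 = w q.1 * w q.2)
    (d : α → α → ℝ) (c : ℝ) (hd : ∀ q ∈ A ×ˢ B, d q.1 (f q).1 ≤ c) :
    ∃ π : α × α → ℝ,
      IsCoupling π (fun a => (∑ x ∈ A with x = a, w x) / ∑ x ∈ A, w x)
        (fun b => (∑ x ∈ B with x = b, w x) / ∑ x ∈ B, w x) ∧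
      ∑ q : α × α, π q * d q.1 q.2 ≤ c := by
  set ZA := ∑ a ∈ A, w a with hZA
  set ZB := ∑ b ∈ B, w b with hZB
  have hfst : ∀ a, ∑ q ∈ A ×ˢ B, (if q.1 = a then w q.1 * w q.2 else 0)
      = (∑ x ∈ A with x = a, w x) * ZB := by
    intro a
    rw [Finset.sum_product, Finset.sum_filter, Finset.sum_mul]
    refine Finset.sum_congr rfl fun x _ => ?_
    split_ifs <;> simp [hZB, Finset.mul_sum]
  have hsnd : ∀ b, ∑ q ∈ A ×ˢ B, (if (f q).1 = b then w q.1 * w q.2 else 0)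
      = (∑ x ∈ B with x = b, w x) * ZA := by
    intro b
    have h : ∑ q ∈ A ×ˢ B, (if (f q).1 = b then w q.1 * w q.2 else 0)
        = ∑ q ∈ B ×ˢ A, (if q.1 = b then w q.1 * w q.2 else 0) :=
      Finset.sum_nbij' f f hAB hBA (fun q _ => hf q) (fun q _ => hf q)
        (fun q _ => by rw [hfw])
    rw [h, Finset.sum_product, Finset.sum_filter, Finset.sum_mul]
    refine Finset.sum_congr rfl fun x _ => ?_
    split_ifs <;> simp [hZA, Finset.mul_sum]
  have htot : ∑ q ∈ A ×ˢ B, w q.1 * w q.2 = ZA * ZB := by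
    rw [Finset.sum_product, hZA, hZB, Finset.sum_mul_sum]
  refine ⟨fun p => (∑ q ∈ A ×ˢ B,
    if q.1 = p.1 ∧ (f q).1 = p.2 then w q.1 * w q.2 else 0) / (ZA * ZB), ⟨?_, ?_, ?_⟩, ?_⟩
  · intro p
    refine div_nonneg (Finset.sum_nonneg fun q _ => ?_) (by positivity)
    split_ifs
    · exact mul_nonneg (hw _) (hw _)
    · exact le_rfl
  · intro a
    rw [← Finset.sum_div, Finset.sum_comm]
    have : ∀ q ∈ A ×ˢ B, (∑ b, if q.1 = a ∧ (f q).1 = b then w q.1 * w q.2 else 0)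
        = if q.1 = a then w q.1 * w q.2 else 0 := by
      intro q _
      by_cases h : q.1 = a <;> simp [h]
    rw [Finset.sum_congr rfl this, hfst]
    field_simp
  · intro b
    rw [← Finset.sum_div, Finset.sum_comm]
    have : ∀ q ∈ A ×ˢ B, (∑ a, if q.1 = a ∧ (f q).1 = b then w q.1 * w q.2 else 0)
        = if (f q).1 = b then w q.1 * w q.2 else 0 := by
      intro q _
      by_cases h : (f q).1 = b <;> simp [h]
    rw [Finset.sum_congr rfl this, hsnd]
    field_simp
  · have hterm : ∀ p : α × α, (∑ q ∈ A ×ˢ B,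
        if q.1 = p.1 ∧ (f q).1 = p.2 then w q.1 * w q.2 else 0) / (ZA * ZB) * d p.1 p.2
        = (∑ q ∈ A ×ˢ B, if (q.1, (f q).1) = p then w q.1 * w q.2 * d q.1 (f q).1 else 0)
          / (ZA * ZB) := by
      intro p
      rw [div_mul_eq_mul_div, Finset.sum_mul]
      congr 1
      refine Finset.sum_congr rfl fun q _ => ?_
      by_cases h : q.1 = p.1 ∧ (f q).1 = p.2
      · rw [if_pos h, if_pos (Prod.ext_iff.mpr h), h.1, h.2]
      · rw [if_neg h, if_neg (fun h' => h (Prod.ext_iff.mp h')), zero_mul]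
    simp only [hterm]
    rw [← Finset.sum_div, Finset.sum_comm, div_le_iff₀ (by positivity), ← htot, Finset.mul_sum]
    refine Finset.sum_le_sum fun q hq => ?_
    rw [Finset.sum_ite_eq, if_pos (Finset.mem_univ _), mul_comm c]
    exact mul_le_mul_of_nonneg_left (hd q hq) (mul_nonneg (hw _) (hw _))

end Coupling

section Component

/-- In a connected graph with all degrees at most two, at most two vertices have degree at
most one. -/
theorem card_degree_le_one_le_two {W : Type*} [Fintype W] [DecidableEq W] (H : SimpleGraph W)
    [DecidableRel H.Adj] (hH : H.Connected) (hdeg : ∀ x, H.degree x ≤ 2) :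
    (Finset.univ.filter fun x => H.degree x ≤ 1).card ≤ 2 := by
  have h1 := hH.card_vert_le_card_edgeSet_add_one
  have h2 := H.sum_degrees_eq_twice_card_edges
  rw [Nat.card_eq_fintype_card, Nat.card_eq_fintype_card, ← SimpleGraph.edgeFinset_card] at h1
  have h3 : ∑ x, (H.degree x + if H.degree x ≤ 1 then 1 else 0) ≤ ∑ _x : W, 2 := by
    refine Finset.sum_le_sum fun x _ => ?_
    have := hdeg x
    split_ifs <;> omega
  rw [Finset.sum_add_distrib, h2, ← Finset.card_filter] at h3
  simp only [Finset.sum_const, Finset.card_univ, smul_eq_mul] at h3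
  omega

/-- The vertices in the connected component of `u` in the graph with edge set `D`. -/
def componentVerts (u : V) (D : Finset (Sym2 V)) : Set V :=
  {x | (SimpleGraph.fromEdgeSet (D : Set (Sym2 V))).Reachable u x}

/-- The edges of `D` lying in the connected component of `u`. -/
noncomputable def componentEdges (u : V) (D : Finset (Sym2 V)) : Finset (Sym2 V) :=
  D.filter fun e => ∃ x ∈ e, x ∈ componentVerts u D

theorem mem_componentEdges_iff {u x : V} {D : Finset (Sym2 V)} {e : Sym2 V} (hx : x ∈ e) :
    e ∈ componentEdges u D ↔ e ∈ D ∧ x ∈ componentVerts u D := by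
  rw [componentEdges, Finset.mem_filter]
  refine ⟨fun ⟨he, y, hy, hyK⟩ => ⟨he, ?_⟩, fun ⟨he, hK⟩ => ⟨he, x, hx, hK⟩⟩
  by_cases hxy : y = x
  · exact hxy ▸ hyK
  · have hadj : (SimpleGraph.fromEdgeSet (D : Set (Sym2 V))).Adj y x := by
      rw [SimpleGraph.fromEdgeSet_adj, ← (Sym2.mem_and_mem_iff hxy).mp ⟨hy, hx⟩]
      exact ⟨he, hxy⟩
    exact SimpleGraph.Reachable.trans hyK hadj.reachable

/-- If every vertex is in at most two edges of `D`, then in the component of `u` at most two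
vertices are in at most one edge of `D`. -/
theorem card_componentVerts_degree_le_one_le_two (u : V) (D : Finset (Sym2 V))
    (hdeg : ∀ x, (D.filter fun e => x ∈ e).card ≤ 2) :
    (Finset.univ.filter fun x => x ∈ componentVerts u D ∧
      (D.filter fun e => x ∈ e).card ≤ 1).card ≤ 2 := by
  set H := SimpleGraph.fromEdgeSet (D : Set (Sym2 V)) with hH
  set K := H.connectedComponentMk u with hK
  have hmem : ∀ x, x ∈ componentVerts u D ↔ x ∈ K.supp := by
    intro x
    rw [SimpleGraph.ConnectedComponent.mem_supp_iff, hK, SimpleGraph.ConnectedComponent.eq]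
    exact ⟨fun h => h.symm, fun h => h.symm⟩
  have hle : ∀ x : K.supp, K.toSimpleGraph.degree x ≤ (D.filter fun e => (x : V) ∈ e).card := by
    intro x
    rw [← SimpleGraph.card_neighborFinset_eq_degree]
    refine Finset.card_le_card_of_injOn (fun y => s((x : V), (y : V))) ?_ ?_
    · intro y hy
      have hy' : K.toSimpleGraph.Adj x y := by simpa using hy
      have hadj : H.Adj x y := hy'
      simpa using ((SimpleGraph.fromEdgeSet_adj _).mp hadj).1
    · intro y _ z _ hyz
      exact Subtype.ext (Sym2.congr_right.mp hyz)
  refine le_trans ?_ (card_degree_le_one_le_two K.toSimpleGraph K.connected_toSimpleGraph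
    fun x => (hle x).trans (hdeg x))
  rw [← Finset.card_map (Function.Embedding.subtype _)]
  refine Finset.card_le_card fun x hx => ?_
  rw [Finset.mem_filter] at hx
  refine Finset.mem_map.mpr ⟨⟨x, (hmem x).mp hx.2.1⟩, ?_, rfl⟩
  exact Finset.mem_filter.mpr ⟨Finset.mem_univ _, (hle _).trans hx.2.2⟩

end Component

set_option linter.unusedSectionVars false

section Swap

/-- The edge set `M` switched along the component of `u` in its symmetric difference with another set. -/
noncomputable def switch (u : V) (M M' : Finset (Sym2 V)) : Finset (Sym2 V) :=
  symmDiff M (componentEdges u (symmDiff M M'))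

theorem symmDiff_switch (u : V) (M M' : Finset (Sym2 V)) :
    symmDiff (switch u M M') (switch u M' M) = symmDiff M M' := by
  rw [switch, switch, symmDiff_comm M' M, symmDiff_symmDiff_symmDiff_comm, symmDiff_self,
    symmDiff_bot]

theorem switch_switch (u : V) (M M' : Finset (Sym2 V)) :
    switch u (switch u M M') (switch u M' M) = M := by
  rw [switch, symmDiff_switch, switch, symmDiff_symmDiff_cancel_right]

theorem card_switch_add_card_switch (u : V) (M M' : Finset (Sym2 V)) :
    (switch u M M').card + (switch u M' M).card = M.card + M'.card := by
  have hcard : ∀ S : Finset (Sym2 V), S.card = ∑ e : Sym2 V, if e ∈ S then 1 else 0 := by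
    intro S
    simp
  rw [hcard, hcard (switch u M' M), hcard M, hcard M', ← Finset.sum_add_distrib,
    ← Finset.sum_add_distrib]
  refine Finset.sum_congr rfl fun e _ => ?_
  have hsub : e ∈ componentEdges u (symmDiff M M') → e ∈ symmDiff M M' :=
    fun h => (Finset.mem_filter.mp h).1
  rw [switch, switch, symmDiff_comm M' M]
  simp only [Finset.mem_symmDiff] at hsub ⊢
  by_cases h1 : e ∈ M <;> by_cases h2 : e ∈ M' <;>
    by_cases h3 : e ∈ componentEdges u (symmDiff M M') <;> simp_all

theorem mem_switch_iff {u x : V} {M M' : Finset (Sym2 V)} {e : Sym2 V} (hx : x ∈ e) :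
    e ∈ switch u M M' ↔ if x ∈ componentVerts u (symmDiff M M') then e ∈ M' else e ∈ M := by
  rw [switch, Finset.mem_symmDiff, mem_componentEdges_iff hx, Finset.mem_symmDiff]
  split_ifs with h <;> tauto

theorem mem_coveredVerts {x : V} {M : Finset (Sym2 V)} :
    x ∈ coveredVerts M ↔ ∃ e ∈ M, x ∈ e := by
  simp [coveredVerts]

theorem mem_coveredVerts_switch {u x : V} {M M' : Finset (Sym2 V)} :
    x ∈ coveredVerts (switch u M M') ↔
      if x ∈ componentVerts u (symmDiff M M') then x ∈ coveredVerts M' else x ∈ coveredVerts M := by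
  rw [mem_coveredVerts, mem_coveredVerts, mem_coveredVerts]
  have h : (∃ e ∈ switch u M M', x ∈ e) ↔
      ∃ e, (if x ∈ componentVerts u (symmDiff M M') then e ∈ M' else e ∈ M) ∧ x ∈ e :=
    exists_congr fun e => and_congr_left fun hx => mem_switch_iff hx
  rw [h]
  split_ifs <;> rfl

theorem IsMatchingSet.switch {G : SimpleGraph V} {M M' : Finset (Sym2 V)}
    (hM : IsMatchingSet G M) (hM' : IsMatchingSet G M') (u : V) :
    IsMatchingSet G (switch u M M') := by
  constructor
  · intro e he
    obtain ⟨x, hx⟩ : ∃ x, x ∈ e := ⟨_, e.out_fst_mem⟩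
    rw [mem_switch_iff hx] at he
    split_ifs at he
    · exact hM'.1 e he
    · exact hM.1 e he
  · intro e he f hf hne x hx hxf
    rw [mem_switch_iff hx] at he
    rw [mem_switch_iff hxf] at hf
    split_ifs at he hf
    · exact hM'.2 e he f hf hne x hx hxf
    · exact hM.2 e he f hf hne x hx hxf

theorem satisfiesPinning_switch {M M' : Finset (Sym2 V)} {Bp Bm : Finset V}
    (hM : satisfiesPinning M Bp Bm) (hM' : satisfiesPinning M' Bp Bm) (u : V) :
    satisfiesPinning (switch u M M') Bp Bm := by
  constructor <;> intro x hx <;> rw [mem_coveredVerts_switch] <;> split_ifs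
  · exact hM'.1 x hx
  · exact hM.1 x hx
  · exact hM'.2 x hx
  · exact hM.2 x hx

theorem self_mem_componentVerts (u : V) (D : Finset (Sym2 V)) : u ∈ componentVerts u D :=
  SimpleGraph.Reachable.refl u

theorem IsMatchingSet.card_filter_mem_le_one {G : SimpleGraph V} {M : Finset (Sym2 V)}
    (hM : IsMatchingSet G M) (x : V) : (M.filter fun e => x ∈ e).card ≤ 1 := by
  refine Finset.card_le_one.mpr fun e he f hf => ?_
  rw [Finset.mem_filter] at he hf
  by_contra hne
  exact hM.2 e he.1 f hf.1 hne x he.2 hf.2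

theorem card_symmDiff_filter_le (M M' : Finset (Sym2 V)) (x : V) :
    ((symmDiff M M').filter fun e => x ∈ e).card ≤
      (M.filter fun e => x ∈ e).card + (M'.filter fun e => x ∈ e).card := by
  refine le_trans (Finset.card_le_card fun e he => ?_) (Finset.card_union_le _ _)
  simp only [Finset.mem_filter, Finset.mem_symmDiff, Finset.mem_union] at he ⊢
  tauto

theorem card_filter_mem_eq_zero {M : Finset (Sym2 V)} {x : V} (hx : x ∉ coveredVerts M) :
    (M.filter fun e => x ∈ e).card = 0 := by
  rw [Finset.card_eq_zero, Finset.filter_eq_empty_iff]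
  exact fun e he hxe => hx (mem_coveredVerts.mpr ⟨e, he, hxe⟩)

/-- Switching along the component of `u`, when `u` is covered by exactly one of the two
matchings, changes the coverage of at most one vertex other than `u`. -/
theorem vdistErase_switch_le_one {G : SimpleGraph V} {M M' : Finset (Sym2 V)}
    (hM : IsMatchingSet G M) (hM' : IsMatchingSet G M') {u : V} (hu' : u ∉ coveredVerts M') :
    vdistErase u M (switch u M M') ≤ 1 := by
  have hdeg : ∀ x, ((symmDiff M M').filter fun e => x ∈ e).card ≤ 2 := fun x =>
    (card_symmDiff_filter_le M M' x).trans
      (Nat.add_le_add (hM.card_filter_mem_le_one x) (hM'.card_filter_mem_le_one x))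
  have htwo := card_componentVerts_degree_le_one_le_two u _ hdeg
  set S := Finset.univ.filter fun x => x ∈ componentVerts u (symmDiff M M') ∧
      ((symmDiff M M').filter fun e => x ∈ e).card ≤ 1 with hS
  have hmemS : ∀ x, x ∈ componentVerts u (symmDiff M M') →
      (x ∉ coveredVerts M ∨ x ∉ coveredVerts M') → x ∈ S := by
    intro x hxK hx
    refine Finset.mem_filter.mpr ⟨Finset.mem_univ _, hxK, ?_⟩
    have h := card_symmDiff_filter_le M M' x
    have h1 := hM.card_filter_mem_le_one x
    have h2 := hM'.card_filter_mem_le_one x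
    rcases hx with hx | hx <;> have h3 := card_filter_mem_eq_zero hx <;> omega
  have huS : u ∈ S := hmemS u (self_mem_componentVerts _ _) (Or.inr hu')
  have hsub : (coveredVerts M \ coveredVerts (switch u M M')) ∪
      (coveredVerts (switch u M M') \ coveredVerts M) ⊆ S := by
    intro x hx
    rw [Finset.mem_union, Finset.mem_sdiff, Finset.mem_sdiff, mem_coveredVerts_switch] at hx
    split_ifs at hx with hxK
    · exact hmemS x hxK (by tauto)
    · tauto
  refine (Finset.card_le_card (Finset.erase_subset_erase u hsub)).trans ?_
  rw [Finset.card_erase_of_mem huS]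
  omega

end Swap

theorem mem_matchings {G : SimpleGraph V} {M : Finset (Sym2 V)} :
    M ∈ matchings G ↔ IsMatchingSet G M := by
  simp [matchings]

theorem condDist_eq (G : SimpleGraph V) (lam : ℝ) (p : Finset (Sym2 V) → Prop)
    [DecidablePred p] :
    condDist G lam p = fun N => (∑ M ∈ (matchings G).filter p with M = N, lam ^ M.card) /
      ∑ M ∈ (matchings G).filter p, lam ^ M.card := by
  funext N
  simp only [condDist, condDistMap, id_eq]
  congr!

/-- At a degree-one vertex `u` with neighbour `v`, the edge `s(u, v)` is the only one. -/
theorem eq_of_mem_of_degr_eq_one {G : SimpleGraph V} {u v : V} (hi : s(u, v) ∈ G.edgeSet)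
    (hdu : degr G u = 1) {e : Sym2 V} (he : e ∈ G.edgeSet) (hue : u ∈ e) : e = s(u, v) := by
  obtain ⟨w, rfl⟩ := Sym2.mem_iff_exists.mp hue
  obtain ⟨a, ha⟩ := Finset.card_eq_one.mp hdu
  have hmem : ∀ x, s(u, x) ∈ G.edgeSet → x = a := fun x hx => by
    rw [← Finset.mem_singleton, ← ha, Finset.mem_filter]
    exact ⟨Finset.mem_univ _, hx⟩
  rw [hmem w he, hmem v hi]

/-- for a pendant edge `i = s(u,v)` with `deg u = 1` and a vertex pinning
`(Bp, Bm)` avoiding `u, v` with both pinned events of positive probability, there is a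
coupling of the two pinned conditional distributions with expected value of
`|(V(M) △ V(M'))∖{u}|` at most `1`. -/
theorem stmt_13 {V : Type*} [Fintype V] [DecidableEq V]
    (G : SimpleGraph V) (lam : ℝ) (hlam : 0 < lam)
    (u v : V) (hi : s(u, v) ∈ G.edgeSet) (hdu : degr G u = 1)
    (Bp Bm : Finset V) (hdisj : Disjoint Bp Bm) (hu : u ∉ Bp ∪ Bm) (hv : v ∉ Bp ∪ Bm)
    (hpos1 : 0 < ∑ M ∈ (matchings G).filter
        (fun M => satisfiesPinning M Bp Bm ∧ s(u, v) ∈ M), lam ^ M.card)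
    (hpos2 : 0 < ∑ M ∈ (matchings G).filter
        (fun M => satisfiesPinning M Bp Bm ∧ s(u, v) ∉ M), lam ^ M.card) :
    ∃ π : Finset (Sym2 V) × Finset (Sym2 V) → ℝ,
      IsCoupling π (condDist G lam (fun M => satisfiesPinning M Bp Bm ∧ s(u, v) ∈ M))
        (condDist G lam (fun M => satisfiesPinning M Bp Bm ∧ s(u, v) ∉ M)) ∧
      ∑ q : Finset (Sym2 V) × Finset (Sym2 V), π q * (vdistErase u q.1 q.2 : ℝ) ≤ 1 := by
  set A := (matchings G).filter fun M => satisfiesPinning M Bp Bm ∧ s(u, v) ∈ M with hA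
  set B := (matchings G).filter fun M => satisfiesPinning M Bp Bm ∧ s(u, v) ∉ M with hB
  have hswitch : ∀ M ∈ A, ∀ M' ∈ B, switch u M M' ∈ B ∧ switch u M' M ∈ A := by
    intro M hM M' hM'
    rw [hA, Finset.mem_filter, mem_matchings] at hM
    rw [hB, Finset.mem_filter, mem_matchings] at hM'
    rw [hA, hB, Finset.mem_filter, Finset.mem_filter, mem_matchings, mem_matchings]
    refine ⟨⟨hM.1.switch hM'.1 u, satisfiesPinning_switch hM.2.1 hM'.2.1 u, ?_⟩,
      ⟨hM'.1.switch hM.1 u, satisfiesPinning_switch hM'.2.1 hM.2.1 u, ?_⟩⟩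
    · rw [mem_switch_iff (Sym2.mem_mk_left u v), if_pos (self_mem_componentVerts _ _)]
      exact hM'.2.2
    · rw [mem_switch_iff (Sym2.mem_mk_left u v), if_pos (self_mem_componentVerts _ _)]
      exact hM.2.2
  rw [condDist_eq, condDist_eq]
  refine exists_coupling_of_involutive A B (fun M => lam ^ M.card) (fun M => by positivity)
    hpos1 hpos2 (fun q => (switch u q.1 q.2, switch u q.2 q.1))
    (fun q => Prod.ext (switch_switch u _ _) (switch_switch u _ _)) ?_ ?_ ?_
    (fun M M' => (vdistErase u M M' : ℝ)) 1 ?_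
  · intro q hq
    rw [Finset.mem_product] at hq ⊢
    exact hswitch _ hq.1 _ hq.2
  · intro q hq
    rw [Finset.mem_product] at hq ⊢
    exact (hswitch _ hq.2 _ hq.1).symm
  · intro q
    simp only [← pow_add, card_switch_add_card_switch]
  · intro q hq
    obtain ⟨h1, h2⟩ := Finset.mem_product.mp hq
    rw [hA, Finset.mem_filter, mem_matchings] at h1
    rw [hB, Finset.mem_filter, mem_matchings] at h2
    refine Nat.cast_le_one.mpr (vdistErase_switch_le_one h1.1 h2.1 fun hcov => ?_)
    obtain ⟨e, he, hue⟩ := mem_coveredVerts.mp hcov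
    exact h2.2.2 (eq_of_mem_of_degr_eq_one hi hdu (h2.1.1 e he) hue ▸ he)

end SensMatching
end

section
/- For integers s ≥ 1 and Δ ≥ 1 and λ > 0, define κ^E_{s,Δ,λ} as the supremum, over all finite simple graphs G = (V,E) with |E| ≤ s and maximum degree at most Δ and all pendant edges i ∈ E, of the Wasserstein distance (with respect to the edge-Hamming distance d(N,N') = |N △ N'|) between the conditional law of M∖{i} given i ∈ M and the conditional law of M given i ∉ M, where M ∼ μ_{G,λ}. Then for every s ≥ 1, κ^E_{s+1,Δ,λ} ≤ (λΔ/(1 + λΔ)) · (κ^E_{s,Δ,λ} + 1). -/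
open scoped Classical

namespace SensMatching

variable {V : Type*} [Fintype V] [DecidableEq V]

/-- `κ^E_{s,Δ,λ}`: the supremum, over graphs with at most `s` edges and maximum degree
at most `Δ` (realized on the vertex set `Fin (2s)`) and pendant edges `i`, of the
edge-Hamming Wasserstein distance between the conditional law of `M∖{i}` given `i ∈ M`
and the conditional law of `M` given `i ∉ M`, for `M ∼ μ_{G,λ}`. -/
noncomputable def kappaE (s Δ : ℕ) (lam : ℝ) : ℝ :=
  sSup {c : ℝ | ∃ (G : SimpleGraph (Fin (2 * s))) (i : Sym2 (Fin (2 * s))),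
    (edges G).card ≤ s ∧ (∀ v, degr G v ≤ Δ) ∧ i ∈ G.edgeSet ∧
    (∃ u, u ∈ i ∧ degr G u = 1) ∧
    c = wass (fun M M' => (edist M M' : ℝ))
        (condDistMap G lam (fun M => i ∈ M) (fun M => M.erase i))
        (condDist G lam (fun M => i ∉ M))}

set_option linter.unusedSectionVars false

/-- There is a coupling of `μ` and `ν` (of possibly unnormalized measures) whose `d`-cost is at
most `c`. -/
def HasCouplingLE {α : Type*} [Fintype α] (d : α → α → ℝ) (μ ν : α → ℝ) (c : ℝ) : Prop :=
  ∃ π : α × α → ℝ, IsCoupling π μ ν ∧ ∑ q : α × α, π q * d q.1 q.2 ≤ c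

/-- The pushforward of the finite measure `μ` under `F`. -/
noncomputable def pushforward {α β : Type*} [Fintype α] (F : α → β) (μ : α → ℝ) (b : β) : ℝ :=
  ∑ a, if F a = b then μ a else 0

namespace HasCouplingLE

variable {α β : Type*} [Fintype α] [Fintype β] {d : α → α → ℝ} {μ ν μ' ν' : α → ℝ} {c c' : ℝ}

lemma symm (hd : ∀ a b, d a b = d b a) (h : HasCouplingLE d μ ν c) : HasCouplingLE d ν μ c := by
  obtain ⟨π, ⟨h0, h1, h2⟩, hc⟩ := h
  refine ⟨fun q => π q.swap, ⟨fun q => h0 _, h2, h1⟩, le_trans (le_of_eq ?_) hc⟩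
  rw [← (Equiv.prodComm α α).sum_comp]
  exact Finset.sum_congr rfl fun q _ => by simp [hd q.1 q.2]

lemma smul {t : ℝ} (ht : 0 ≤ t) (h : HasCouplingLE d μ ν c) :
    HasCouplingLE d (fun a => t * μ a) (fun a => t * ν a) (t * c) := by
  obtain ⟨π, ⟨h0, h1, h2⟩, hc⟩ := h
  refine ⟨fun q => t * π q, ⟨fun q => mul_nonneg ht (h0 q), fun a => ?_, fun b => ?_⟩, ?_⟩
  · rw [← Finset.mul_sum, h1]
  · rw [← Finset.mul_sum, h2]
  · simp_rw [mul_assoc, ← Finset.mul_sum]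
    exact mul_le_mul_of_nonneg_left hc ht

lemma add (h : HasCouplingLE d μ ν c) (h' : HasCouplingLE d μ' ν' c') :
    HasCouplingLE d (fun a => μ a + μ' a) (fun a => ν a + ν' a) (c + c') := by
  obtain ⟨π, ⟨h0, h1, h2⟩, hc⟩ := h
  obtain ⟨π', ⟨h0', h1', h2'⟩, hc'⟩ := h'
  refine ⟨fun q => π q + π' q, ⟨fun q => add_nonneg (h0 q) (h0' q), fun a => ?_, fun b => ?_⟩, ?_⟩
  · rw [Finset.sum_add_distrib, h1, h1']
  · rw [Finset.sum_add_distrib, h2, h2']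
  · simp_rw [add_mul, Finset.sum_add_distrib]
    exact add_le_add hc hc'

lemma diagonal (hd : ∀ a, d a a = 0) (hμ : ∀ a, 0 ≤ μ a) : HasCouplingLE d μ μ 0 := by
  refine ⟨fun q => if q.1 = q.2 then μ q.1 else 0, ⟨fun q => ?_, fun a => ?_, fun b => ?_⟩, ?_⟩
  · dsimp only
    split_ifs
    exacts [hμ _, le_rfl]
  · simp
  · simp
  · refine (Finset.sum_eq_zero fun q _ => ?_).le
    dsimp only
    split_ifs with h
    · rw [h, hd, mul_zero]
    · rw [zero_mul]

lemma sum {ι : Type*} (I : Finset ι) {μ ν : ι → α → ℝ} {c : ι → ℝ}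
    (h : ∀ j ∈ I, HasCouplingLE d (μ j) (ν j) (c j)) :
    HasCouplingLE d (fun a => ∑ j ∈ I, μ j a) (fun a => ∑ j ∈ I, ν j a) (∑ j ∈ I, c j) := by
  induction I using Finset.induction_on with
  | empty => exact ⟨fun _ => 0, by simp [IsCoupling], by simp⟩
  | insert j I hj ih =>
    simp_rw [Finset.sum_insert hj]
    exact (h j (Finset.mem_insert_self _ _)).add
      (ih fun k hk => h k (Finset.mem_insert_of_mem hk))

lemma map {d' : β → β → ℝ} (F F' : α → β) {k m : ℝ}
    (hd : ∀ a b, d' (F a) (F' b) ≤ d a b + k) (hm : ∑ a, μ a = m)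
    (h : HasCouplingLE d μ ν c) :
    HasCouplingLE d' (pushforward F μ) (pushforward F' ν) (c + k * m) := by
  obtain ⟨π, ⟨h0, h1, h2⟩, hc⟩ := h
  refine ⟨fun r => ∑ q : α × α, if F q.1 = r.1 ∧ F' q.2 = r.2 then π q else 0,
    ⟨fun r => Finset.sum_nonneg fun q _ => ?_, fun x => ?_, fun y => ?_⟩, ?_⟩
  · split_ifs
    exacts [h0 q, le_rfl]
  · rw [Finset.sum_comm, Fintype.sum_prod_type]
    refine Finset.sum_congr rfl fun a _ => ?_
    by_cases hx : F a = x <;> simp [hx, h1]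
  · rw [Finset.sum_comm, Fintype.sum_prod_type_right]
    refine Finset.sum_congr rfl fun a _ => ?_
    by_cases hx : F' a = y <;> simp [hx, h2]
  · have key : ∑ r : β × β, (∑ q : α × α, if F q.1 = r.1 ∧ F' q.2 = r.2 then π q else 0)
        * d' r.1 r.2 = ∑ q : α × α, π q * d' (F q.1) (F' q.2) := by
      simp_rw [Finset.sum_mul]
      rw [Finset.sum_comm]
      refine Finset.sum_congr rfl fun q _ => ?_
      rw [Finset.sum_eq_single (F q.1, F' q.2)]
      · simp
      · intro r _ hr
        rw [if_neg, zero_mul]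
        rintro ⟨h1, h2⟩
        exact hr (Prod.ext h1.symm h2.symm)
      · simp
    have hmass : ∑ q : α × α, π q = m := by
      rw [Fintype.sum_prod_type, ← hm]
      exact Finset.sum_congr rfl fun a _ => h1 a
    calc _ = ∑ q : α × α, π q * d' (F q.1) (F' q.2) := key
      _ ≤ ∑ q : α × α, (π q * d q.1 q.2 + k * π q) := Finset.sum_le_sum fun q _ => by
          nlinarith [mul_le_mul_of_nonneg_left (hd q.1 q.2) (h0 q)]
      _ ≤ c + k * m := by
          rw [Finset.sum_add_distrib, ← Finset.mul_sum, hmass]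
          linarith

end HasCouplingLE

section Wasserstein

variable {α : Type*} [Fintype α] {d : α → α → ℝ} {μ ν : α → ℝ} {c : ℝ}

lemma wass_cost_nonneg (hd : ∀ a b, 0 ≤ d a b) {x : ℝ}
    (hx : ∃ π : α × α → ℝ, IsCoupling π μ ν ∧ x = ∑ q : α × α, π q * d q.1 q.2) : 0 ≤ x := by
  obtain ⟨π, hπ, rfl⟩ := hx
  exact Finset.sum_nonneg fun q _ => mul_nonneg (hπ.1 q) (hd _ _)

lemma wass_nonneg (hd : ∀ a b, 0 ≤ d a b) : 0 ≤ wass d μ ν :=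
  Real.sInf_nonneg fun _ hx => wass_cost_nonneg hd hx

lemma HasCouplingLE.wass_le (hd : ∀ a b, 0 ≤ d a b) (h : HasCouplingLE d μ ν c) :
    wass d μ ν ≤ c := by
  obtain ⟨π, hπ, hc⟩ := h
  exact (csInf_le ⟨0, fun _ hx => wass_cost_nonneg hd hx⟩ ⟨π, hπ, rfl⟩).trans hc

lemma HasCouplingLE.of_wass_lt (hμ : ∀ a, 0 ≤ μ a) (hν : ∀ a, 0 ≤ ν a) (hμ1 : ∑ a, μ a = 1)
    (hν1 : ∑ a, ν a = 1) (h : wass d μ ν < c) : HasCouplingLE d μ ν c := by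
  have hne : {x : ℝ | ∃ π : α × α → ℝ, IsCoupling π μ ν ∧
      x = ∑ q : α × α, π q * d q.1 q.2}.Nonempty := by
    refine ⟨_, fun q => μ q.1 * ν q.2,
      ⟨fun q => mul_nonneg (hμ _) (hν _), fun a => ?_, fun b => ?_⟩, rfl⟩
    · simp only [← Finset.mul_sum, hν1, mul_one]
    · simp only [← Finset.sum_mul, hμ1, one_mul]
  obtain ⟨x, ⟨π, hπ, rfl⟩, hx⟩ := exists_lt_of_csInf_lt hne h
  exact ⟨π, hπ, hx.le⟩

end Wasserstein

lemma edist_comm' (M N : Finset (Sym2 V)) : edist M N = edist N M := by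
  unfold edist
  rw [Finset.union_comm]

lemma edist_insert_le (e : Sym2 V) (M N : Finset (Sym2 V)) :
    edist M (insert e N) ≤ edist M N + 1 := by
  unfold edist
  refine (Finset.card_le_card (t := insert e (M \ N ∪ N \ M)) ?_).trans (Finset.card_insert_le _ _)
  intro x
  simp only [Finset.mem_union, Finset.mem_sdiff, Finset.mem_insert]
  tauto

lemma edist_image {W : Type*} [Fintype W] [DecidableEq W] {f : Sym2 V → Sym2 W}
    (hf : Function.Injective f) (M N : Finset (Sym2 V)) :
    edist (M.image f) (N.image f) = edist M N := by
  unfold edist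
  rw [← Finset.image_sdiff _ _ hf, ← Finset.image_sdiff _ _ hf, ← Finset.image_union,
    Finset.card_image_of_injective _ hf]

section Weight

variable {E : Type*} [Fintype E] [DecidableEq E] {lam : ℝ}

/-- The unnormalized Gibbs weight restricted to the family `S`. -/
noncomputable def weight (lam : ℝ) (S : Finset (Finset E)) (N : Finset E) : ℝ :=
  if N ∈ S then lam ^ N.card else 0

/-- The total Gibbs weight of the family `S`. -/
noncomputable def totalWeight (lam : ℝ) (S : Finset (Finset E)) : ℝ :=
  ∑ N ∈ S, lam ^ N.card

/-- The Gibbs distribution conditioned on the family `S`. -/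
noncomputable def law (lam : ℝ) (S : Finset (Finset E)) (N : Finset E) : ℝ :=
  (totalWeight lam S)⁻¹ * weight lam S N

lemma sum_weight (S : Finset (Finset E)) : ∑ N, weight lam S N = totalWeight lam S := by
  simp [weight, totalWeight]

lemma weight_nonneg (hlam : 0 < lam) (S : Finset (Finset E)) (N : Finset E) :
    0 ≤ weight lam S N := by
  unfold weight
  split_ifs
  exacts [by positivity, le_rfl]

lemma totalWeight_pos (hlam : 0 < lam) {S : Finset (Finset E)} (hS : S.Nonempty) :
    0 < totalWeight lam S :=
  Finset.sum_pos (fun _ _ => by positivity) hS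

lemma law_nonneg (hlam : 0 < lam) (S : Finset (Finset E)) (N : Finset E) : 0 ≤ law lam S N :=
  mul_nonneg (inv_nonneg.2 (Finset.sum_nonneg fun _ _ => by positivity)) (weight_nonneg hlam S N)

lemma sum_law (hlam : 0 < lam) {S : Finset (Finset E)} (hS : S.Nonempty) :
    ∑ N, law lam S N = 1 := by
  unfold law
  rw [← Finset.mul_sum, sum_weight, inv_mul_cancel₀ (totalWeight_pos hlam hS).ne']

lemma totalWeight_mul_law (hlam : 0 < lam) {S : Finset (Finset E)} (hS : S.Nonempty)
    (N : Finset E) : totalWeight lam S * law lam S N = weight lam S N := by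
  unfold law
  rw [mul_inv_cancel_left₀ (totalWeight_pos hlam hS).ne']

lemma pushforward_weight {E' : Type*} [DecidableEq E'] (S : Finset (Finset E))
    (F : Finset E → Finset E') (hF : Set.InjOn F S) (r : ℕ)
    (hr : ∀ N ∈ S, (F N).card = N.card + r) (t : ℝ) (N : Finset E') :
    pushforward F (fun M => t * lam ^ r * weight lam S M) N = t * weight lam (S.image F) N := by
  unfold pushforward weight
  by_cases hN : N ∈ S.image F
  · obtain ⟨M, hM, rfl⟩ := Finset.mem_image.1 hN
    rw [Finset.sum_eq_single M]
    · simp only [if_true, hM, hN, hr M hM]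
      ring
    · intro M' _ hne
      split_ifs with h1
      · have hM' : M' ∉ S := fun hM' => hne (hF hM' hM h1)
        simp [hM']
      · rfl
    · simp
  · rw [if_neg hN, mul_zero]
    refine Finset.sum_eq_zero fun M _ => ?_
    split_ifs with h1
    · have hM : M ∉ S := fun hM => hN (Finset.mem_image.2 ⟨M, hM, h1⟩)
      simp [hM]
    · rfl

lemma totalWeight_image {E' : Type*} [DecidableEq E'] (S : Finset (Finset E))
    (F : Finset E → Finset E') (hF : Set.InjOn F S) (r : ℕ)
    (hr : ∀ N ∈ S, (F N).card = N.card + r) :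
    totalWeight lam (S.image F) = lam ^ r * totalWeight lam S := by
  unfold totalWeight
  rw [Finset.sum_image hF, Finset.mul_sum]
  exact Finset.sum_congr rfl fun N hN => by rw [hr N hN, pow_add, mul_comm]

lemma pushforward_law {E' : Type*} [DecidableEq E'] (S : Finset (Finset E))
    (F : Finset E → Finset E') (hF : Set.InjOn F S) (hr : ∀ N ∈ S, (F N).card = N.card) :
    pushforward F (law lam S) = law lam (S.image F) := by
  funext N
  have h := pushforward_weight (lam := lam) S F hF 0 hr (totalWeight lam S)⁻¹ N
  have hZ := totalWeight_image (lam := lam) S F hF 0 hr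
  simp only [pow_zero, mul_one, one_mul] at h hZ
  unfold law
  rw [h, hZ]

end Weight

/-- The sets `M \ {i}` for the matchings `M` of `G` containing `i`. -/
noncomputable def matchingsWith (G : SimpleGraph V) (i : Sym2 V) : Finset (Finset (Sym2 V)) :=
  Finset.univ.filter fun N => i ∉ N ∧ IsMatchingSet G (insert i N)

/-- The matchings of `G` that do not contain `i`. -/
noncomputable def matchingsWithout (G : SimpleGraph V) (i : Sym2 V) : Finset (Finset (Sym2 V)) :=
  Finset.univ.filter fun N => i ∉ N ∧ IsMatchingSet G N

@[simp] lemma mem_matchingsWith {G : SimpleGraph V} {i : Sym2 V} {N : Finset (Sym2 V)} :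
    N ∈ matchingsWith G i ↔ i ∉ N ∧ IsMatchingSet G (insert i N) := by
  simp [matchingsWith]

@[simp] lemma mem_matchingsWithout {G : SimpleGraph V} {i : Sym2 V} {N : Finset (Sym2 V)} :
    N ∈ matchingsWithout G i ↔ i ∉ N ∧ IsMatchingSet G N := by
  simp [matchingsWithout]

lemma card_insert_of_mem_matchingsWith {G : SimpleGraph V} {i : Sym2 V} {N : Finset (Sym2 V)}
    (hN : N ∈ matchingsWith G i) : (insert i N).card = N.card + 1 :=
  Finset.card_insert_of_notMem (mem_matchingsWith.1 hN).1

lemma insert_injOn_matchingsWith (G : SimpleGraph V) (i : Sym2 V) :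
    Set.InjOn (insert i) (matchingsWith G i : Set (Finset (Sym2 V))) := by
  intro M hM N hN h
  rw [← Finset.erase_insert (mem_matchingsWith.1 hM).1,
    ← Finset.erase_insert (mem_matchingsWith.1 hN).1]
  exact congrArg (fun X : Finset (Sym2 V) => X.erase i) h

lemma matchingsWith_nonempty {G : SimpleGraph V} {i : Sym2 V} (hi : i ∈ G.edgeSet) :
    (matchingsWith G i).Nonempty := by
  refine ⟨∅, ?_⟩
  simp only [mem_matchingsWith, IsMatchingSet, Finset.notMem_empty, not_false_eq_true,
    Finset.mem_insert, or_false, true_and]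
  exact ⟨fun e he => he ▸ hi, fun e he f hf hne => absurd (he.trans hf.symm) hne⟩

lemma matchingsWithout_nonempty (G : SimpleGraph V) (i : Sym2 V) :
    (matchingsWithout G i).Nonempty :=
  ⟨∅, by simp [IsMatchingSet]⟩

lemma condDist_eq_law (G : SimpleGraph V) (lam : ℝ) (i : Sym2 V) :
    condDist G lam (fun M => i ∉ M) = law lam (matchingsWithout G i) := by
  have hS : (matchings G).filter (fun M => i ∉ M) = matchingsWithout G i := by
    ext N
    simp [matchings, and_comm]
  funext N
  have hnum : ∑ M ∈ (matchingsWithout G i).filter (fun M => M = N), lam ^ M.card =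
      weight lam (matchingsWithout G i) N := by
    simp [Finset.sum_filter, weight]
  unfold condDist condDistMap law totalWeight
  rw [div_eq_inv_mul, ← hnum, ← hS]
  simp only [id]
  congr!

lemma condDistMap_erase_eq_law (G : SimpleGraph V) {lam : ℝ} (hlam : 0 < lam) (i : Sym2 V) :
    condDistMap G lam (fun M => i ∈ M) (fun M => M.erase i) = law lam (matchingsWith G i) := by
  have hS : (matchings G).filter (fun M => i ∈ M) = (matchingsWith G i).image (insert i) := by
    ext N
    simp only [matchings, Finset.mem_filter, Finset.mem_univ, true_and, Finset.mem_image,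
      mem_matchingsWith]
    constructor
    · rintro ⟨h1, h2⟩
      exact ⟨N.erase i, ⟨Finset.notMem_erase _ _, by rwa [Finset.insert_erase h2]⟩,
        Finset.insert_erase h2⟩
    · rintro ⟨M, ⟨-, h⟩, rfl⟩
      exact ⟨h, Finset.mem_insert_self _ _⟩
  have hinj := insert_injOn_matchingsWith G i
  have hcard : ∀ N ∈ matchingsWith G i, (insert i N).card = N.card + 1 := fun N hN =>
    card_insert_of_mem_matchingsWith hN
  have hZ := totalWeight_image (lam := lam) _ _ hinj 1 hcard
  funext N
  have hnum : (∑ M ∈ ((matchings G).filter fun M => i ∈ M).filter fun M => M.erase i = N,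
      lam ^ M.card) = lam * weight lam (matchingsWith G i) N := by
    rw [hS, Finset.sum_filter, Finset.sum_image hinj]
    unfold weight
    rw [mul_ite, mul_zero, ← Finset.sum_ite_eq' (matchingsWith G i) N (fun M => lam * lam ^ M.card)]
    refine Finset.sum_congr rfl fun M hM => ?_
    rw [Finset.erase_insert (mem_matchingsWith.1 hM).1, hcard M hM, pow_succ']
  calc condDistMap G lam (fun M => i ∈ M) (fun M => M.erase i) N
      = (∑ M ∈ ((matchings G).filter fun M => i ∈ M).filter fun M => M.erase i = N,
        lam ^ M.card) / totalWeight lam ((matchings G).filter fun M => i ∈ M) := by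
        unfold condDistMap totalWeight
        congr!
    _ = law lam (matchingsWith G i) N := by
        rw [hnum, hS, hZ, pow_one, mul_div_mul_left _ _ hlam.ne', div_eq_inv_mul, law]

lemma IsMatchingSet.mono {G : SimpleGraph V} {M N : Finset (Sym2 V)} (h : IsMatchingSet G N)
    (hMN : M ⊆ N) : IsMatchingSet G M :=
  ⟨fun e he => h.1 e (hMN he), fun e he f hf => h.2 e (hMN he) f (hMN hf)⟩

lemma isMatchingSet_insert {G : SimpleGraph V} {M : Finset (Sym2 V)} {i : Sym2 V} (hi : i ∉ M) :
    IsMatchingSet G (insert i M) ↔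
      i ∈ G.edgeSet ∧ IsMatchingSet G M ∧ ∀ e ∈ M, ∀ x ∈ e, x ∉ i := by
  constructor
  · intro h
    refine ⟨h.1 i (Finset.mem_insert_self _ _), h.mono (Finset.subset_insert _ _), ?_⟩
    intro e he x hx
    exact h.2 e (Finset.mem_insert_of_mem he) i (Finset.mem_insert_self _ _)
      (fun h => hi (h ▸ he)) x hx
  · rintro ⟨h1, h2, h3⟩
    refine ⟨fun e he => ?_, fun e he f hf hne x hx => ?_⟩
    · rcases Finset.mem_insert.1 he with rfl | he
      exacts [h1, h2.1 e he]
    · rcases Finset.mem_insert.1 he with rfl | he <;> rcases Finset.mem_insert.1 hf with rfl | hf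
      · exact absurd rfl hne
      · exact fun hxf => h3 f hf x hxf hx
      · exact h3 e (by assumption) x hx
      · exact h2.2 e he f hf hne x hx

lemma mem_matchingsWith_pendant {G : SimpleGraph V} {u v : V} (huv : G.Adj u v)
    (hu : ∀ x, G.Adj u x → x = v) {N : Finset (Sym2 V)} :
    N ∈ matchingsWith G s(u, v) ↔ IsMatchingSet G N ∧ ∀ e ∈ N, v ∉ e := by
  rw [mem_matchingsWith]
  constructor
  · rintro ⟨h1, h2⟩
    rw [isMatchingSet_insert h1] at h2
    exact ⟨h2.2.1, fun e he hv => h2.2.2 e he v hv (Sym2.mem_mk_right u v)⟩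
  · rintro ⟨h1, h2⟩
    have h3 : s(u, v) ∉ N := fun h => h2 _ h (Sym2.mem_mk_right u v)
    refine ⟨h3, (isMatchingSet_insert h3).2 ⟨huv, h1, fun e he x hx hxi => ?_⟩⟩
    rcases Sym2.mem_iff.1 hxi with rfl | rfl
    · obtain ⟨y, rfl⟩ := Sym2.mem_iff_exists.1 hx
      exact h2 _ he (hu y (h1.1 _ he) ▸ Sym2.mem_mk_right x y)
    · exact h2 e he hx

/-- The graph obtained from `G` by deleting every edge at `v` except `s(v, w)`. -/
def isolateExcept (G : SimpleGraph V) (v w : V) : SimpleGraph V :=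
  SimpleGraph.fromEdgeSet {e | e ∈ G.edgeSet ∧ (e = s(v, w) ∨ v ∉ e)}

lemma mem_edgeSet_isolateExcept {G : SimpleGraph V} {v w : V} {e : Sym2 V} :
    e ∈ (isolateExcept G v w).edgeSet ↔ e ∈ G.edgeSet ∧ (e = s(v, w) ∨ v ∉ e) := by
  unfold isolateExcept
  rw [SimpleGraph.edgeSet_fromEdgeSet]
  constructor
  · exact fun h => h.1
  · exact fun h => ⟨h, G.not_isDiag_of_mem_edgeSet h.1⟩

lemma isolateExcept_le (G : SimpleGraph V) (v w : V) : isolateExcept G v w ≤ G :=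
  SimpleGraph.edgeSet_subset_edgeSet.1 fun _ he => (mem_edgeSet_isolateExcept.1 he).1

lemma isolateExcept_adj {G : SimpleGraph V} {v w : V} (h : G.Adj v w) :
    (isolateExcept G v w).Adj v w :=
  mem_edgeSet_isolateExcept.2 ⟨h, Or.inl rfl⟩

lemma eq_of_isolateExcept_adj {G : SimpleGraph V} {v w x : V}
    (h : (isolateExcept G v w).Adj v x) : x = w := by
  rw [← SimpleGraph.mem_edgeSet, mem_edgeSet_isolateExcept] at h
  rcases h.2 with h | h
  · exact Sym2.congr_right.1 h
  · exact absurd (Sym2.mem_mk_left v x) h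

lemma IsMatchingSet.of_edges {G H : SimpleGraph V} {N : Finset (Sym2 V)} (h : IsMatchingSet G N)
    (hH : ∀ e ∈ N, e ∈ H.edgeSet) : IsMatchingSet H N :=
  ⟨hH, h.2⟩

lemma matchingsWithout_isolateExcept {G : SimpleGraph V} {u v w : V} (huv : G.Adj u v)
    (hu : ∀ x, G.Adj u x → x = v) :
    matchingsWithout (isolateExcept G v w) s(v, w) = matchingsWith G s(u, v) := by
  ext N
  rw [mem_matchingsWith_pendant huv hu, mem_matchingsWithout]
  constructor
  · rintro ⟨h1, h2⟩
    have h3 := fun e he => mem_edgeSet_isolateExcept.1 (h2.1 e he)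
    exact ⟨h2.of_edges fun e he => (h3 e he).1,
      fun e he => (h3 e he).2.resolve_left fun h => h1 (h ▸ he)⟩
  · rintro ⟨h1, h2⟩
    exact ⟨fun h => h2 _ h (Sym2.mem_mk_left v w), h1.of_edges fun e he =>
      mem_edgeSet_isolateExcept.2 ⟨h1.1 e he, Or.inr (h2 e he)⟩⟩

lemma matchingsWith_isolateExcept_subset {G : SimpleGraph V} {u v w : V} (huv : G.Adj u v)
    (hu : ∀ x, G.Adj u x → x = v) :
    matchingsWith (isolateExcept G v w) s(v, w) ⊆ matchingsWith G s(u, v) := by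
  intro N hN
  rw [← matchingsWithout_isolateExcept (w := w) huv hu]
  rw [mem_matchingsWith] at hN
  exact mem_matchingsWithout.2 ⟨hN.1, hN.2.mono (Finset.subset_insert _ _)⟩

lemma image_matchingsWith_isolateExcept {G : SimpleGraph V} {u v w : V} (hwu : w ≠ u) :
    (matchingsWith (isolateExcept G v w) s(v, w)).image (insert s(v, w)) =
      (matchingsWithout G s(u, v)).filter fun N => s(v, w) ∈ N := by
  ext N
  simp only [Finset.mem_image, mem_matchingsWith, Finset.mem_filter, mem_matchingsWithout]
  have hne : s(u, v) ≠ s(v, w) := by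
    rw [Sym2.eq_swap]
    exact fun h => hwu (Sym2.congr_right.1 h).symm
  constructor
  · rintro ⟨M, ⟨h1, h2⟩, rfl⟩
    have h3 := h2.of_edges (H := G) fun e he => (mem_edgeSet_isolateExcept.1 (h2.1 e he)).1
    refine ⟨⟨fun h => ?_, h3⟩, Finset.mem_insert_self _ _⟩
    exact h3.2 _ h _ (Finset.mem_insert_self _ _) hne v (Sym2.mem_mk_right u v)
      (Sym2.mem_mk_left v w)
  · rintro ⟨⟨h1, h2⟩, h3⟩
    refine ⟨N.erase s(v, w), ⟨Finset.notMem_erase _ _, ?_⟩, Finset.insert_erase h3⟩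
    rw [Finset.insert_erase h3]
    refine h2.of_edges fun e he => mem_edgeSet_isolateExcept.2 ⟨h2.1 e he, ?_⟩
    by_cases hev : e = s(v, w)
    · exact Or.inl hev
    · exact Or.inr fun hv => h2.2 e he _ h3 hev v hv (Sym2.mem_mk_left v w)

lemma weight_matchingsWithout {G : SimpleGraph V} {u v : V} (lam : ℝ) (huv : G.Adj u v)
    (hu : ∀ x, G.Adj u x → x = v) (N : Finset (Sym2 V)) :
    weight lam (matchingsWithout G s(u, v)) N = weight lam (matchingsWith G s(u, v)) N +
      ∑ w ∈ Finset.univ.filter (fun w => G.Adj v w ∧ w ≠ u),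
        weight lam ((matchingsWithout G s(u, v)).filter fun N => s(v, w) ∈ N) N := by
  unfold weight
  simp only [Finset.mem_filter, mem_matchingsWith_pendant huv hu]
  by_cases hN : N ∈ matchingsWithout G s(u, v)
  · have hN' := mem_matchingsWithout.1 hN
    simp only [hN, true_and, if_true, hN'.2]
    by_cases hv : ∀ e ∈ N, v ∉ e
    · rw [if_pos hv, Finset.sum_eq_zero, add_zero]
      intro w _
      exact if_neg fun h => hv _ h (Sym2.mem_mk_left v w)
    · rw [if_neg hv, zero_add]
      push Not at hv
      obtain ⟨e, he, hve⟩ := hv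
      obtain ⟨w, rfl⟩ := Sym2.mem_iff_exists.1 hve
      rw [Finset.sum_eq_single w, if_pos he]
      · intro x _ hx
        refine if_neg fun hxN => ?_
        exact hN'.2.2 _ hxN _ he (fun h => hx (Sym2.congr_right.1 h)) v (Sym2.mem_mk_left v x) hve
      · intro hw
        refine absurd (Finset.mem_filter.2 ⟨Finset.mem_univ _, hN'.2.1 _ he, ?_⟩) hw
        rintro rfl
        exact hN'.1 (Sym2.eq_swap ▸ he)
  · have h1 : ¬ (IsMatchingSet G N ∧ ∀ e ∈ N, v ∉ e) := fun h =>
      hN (mem_matchingsWithout.2 ⟨fun h' => h.2 _ h' (Sym2.mem_mk_right u v), h.1⟩)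
    simp [hN, h1]

lemma hasCouplingLE_of_isolateExcept {G : SimpleGraph V} {u v : V} {lam c : ℝ} {Δ : ℕ}
    (hlam : 0 < lam) (hc : 0 ≤ c) (huv : G.Adj u v) (hu : ∀ x, G.Adj u x → x = v)
    (hdeg : degr G v ≤ Δ)
    (h : ∀ w, G.Adj v w → w ≠ u → HasCouplingLE (fun M M' => (edist M M' : ℝ))
      (law lam (matchingsWith (isolateExcept G v w) s(v, w)))
      (law lam (matchingsWithout (isolateExcept G v w) s(v, w))) c) :
    HasCouplingLE (fun M M' => (edist M M' : ℝ)) (law lam (matchingsWith G s(u, v)))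
      (law lam (matchingsWithout G s(u, v))) (lam * Δ / (1 + lam * Δ) * (c + 1)) := by
  set A := matchingsWith G s(u, v) with hA
  set B := matchingsWithout G s(u, v) with hB
  set I := Finset.univ.filter (fun w => G.Adj v w ∧ w ≠ u) with hI
  set Aw : V → Finset (Finset (Sym2 V)) := fun w =>
    matchingsWith (isolateExcept G v w) s(v, w) with hAw
  have hAne : A.Nonempty := matchingsWith_nonempty huv
  have hBne : B.Nonempty := matchingsWithout_nonempty G _
  have hZA := totalWeight_pos hlam hAne
  have hZB := totalWeight_pos hlam hBne
  have hstep : ∀ w ∈ I, HasCouplingLE (fun M M' => (edist M M' : ℝ))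
      (fun N => lam * totalWeight lam (Aw w) * (totalWeight lam A)⁻¹ * weight lam A N)
      (weight lam (B.filter fun N => s(v, w) ∈ N)) (lam * totalWeight lam (Aw w) * (c + 1)) := by
    intro w hw
    obtain ⟨-, hvw, hwu⟩ := Finset.mem_filter.1 hw
    have hne : (Aw w).Nonempty := matchingsWith_nonempty (isolateExcept_adj hvw)
    have hpos := totalWeight_pos hlam hne
    have h1 := h w hvw hwu
    rw [matchingsWithout_isolateExcept huv hu] at h1
    have h2 := (h1.symm fun a b => by rw [edist_comm']).smul (mul_pos hlam hpos).le
    have h3 := h2.map (d' := fun M M' => (edist M M' : ℝ)) id (insert s(v, w)) (k := 1)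
      (fun a b => by exact_mod_cast edist_insert_le _ _ _) rfl
    convert h3 using 1
    · funext N
      have hid : ∀ μ : Finset (Sym2 V) → ℝ, pushforward id μ N = μ N := fun μ => by
        unfold pushforward
        exact (Finset.sum_eq_single N (fun M _ hM => if_neg hM)
          fun hN => absurd (Finset.mem_univ _) hN).trans (if_pos rfl)
      rw [hid, law, mul_assoc]
    · funext N
      have h4 := pushforward_weight (lam := lam) (Aw w) _ (insert_injOn_matchingsWith _ _) 1
        (fun N hN => card_insert_of_mem_matchingsWith hN) 1 N
      rw [image_matchingsWith_isolateExcept hwu, one_mul (weight _ _ _)] at h4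
      refine h4.symm.trans ?_
      congr 1
      funext M
      rw [one_mul, pow_one, mul_assoc]
      exact congrArg (lam * ·) (totalWeight_mul_law hlam hne M).symm
    · rw [← Finset.mul_sum, sum_law hlam hAne]
      ring
  have hZ : totalWeight lam B = totalWeight lam A + ∑ w ∈ I, lam * totalWeight lam (Aw w) := by
    rw [← sum_weight, Finset.sum_congr rfl fun N _ => weight_matchingsWithout lam huv hu N,
      Finset.sum_add_distrib, sum_weight, Finset.sum_comm]
    congr 1
    refine Finset.sum_congr rfl fun w hw => ?_
    rw [sum_weight, ← image_matchingsWith_isolateExcept (Finset.mem_filter.1 hw).2.2,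
      totalWeight_image _ _ (insert_injOn_matchingsWith _ _) 1
        (fun N hN => card_insert_of_mem_matchingsWith hN), pow_one]
  have hle : ∑ w ∈ I, lam * totalWeight lam (Aw w) ≤ Δ * (lam * totalWeight lam A) := by
    have hIc : I.card ≤ Δ := (Finset.card_le_card fun w hw => by
      simp only [hI, Finset.mem_filter] at hw ⊢
      exact ⟨hw.1, hw.2.1⟩).trans hdeg
    calc _ ≤ ∑ w ∈ I, lam * totalWeight lam A := Finset.sum_le_sum fun w _ =>
          mul_le_mul_of_nonneg_left (Finset.sum_le_sum_of_subset_of_nonneg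
            (matchingsWith_isolateExcept_subset huv hu) fun _ _ _ => by positivity) hlam.le
      _ = I.card * (lam * totalWeight lam A) := by rw [Finset.sum_const, nsmul_eq_mul]
      _ ≤ _ := by gcongr
  have hdiag := HasCouplingLE.diagonal (d := fun M M' : Finset (Sym2 V) => (edist M M' : ℝ))
    (fun a => by simp [edist]) (weight_nonneg hlam A)
  have hall := (hdiag.add (HasCouplingLE.sum I hstep)).smul (inv_nonneg.2 hZB.le)
  have hgoal : HasCouplingLE (fun M M' => (edist M M' : ℝ)) (law lam A) (law lam B)
      ((totalWeight lam B)⁻¹ * (0 + ∑ w ∈ I, lam * totalWeight lam (Aw w) * (c + 1))) := by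
    convert hall using 1
    · funext N
      rw [← Finset.sum_mul, ← Finset.sum_mul]
      unfold law
      field_simp
      rw [hZ]
    · funext N
      rw [← weight_matchingsWithout lam huv hu]
      rfl
  obtain ⟨π, hπ, hcost⟩ := hgoal
  refine ⟨π, hπ, hcost.trans ?_⟩
  rw [zero_add, ← Finset.sum_mul, ← mul_assoc]
  refine mul_le_mul_of_nonneg_right ?_ (by linarith)
  rw [← div_eq_inv_mul, div_le_div_iff₀ hZB (by positivity)]
  rw [hZ]
  nlinarith

section Transport

variable {W : Type*} [Fintype W] [DecidableEq W]

lemma mem_edgeSet_comap (G : SimpleGraph V) (f : W ↪ V) (e : Sym2 W) :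
    e ∈ (G.comap f).edgeSet ↔ Sym2.map f e ∈ G.edgeSet := by
  induction e with | _ x y => rfl

lemma isMatchingSet_comap {G : SimpleGraph V} {f : W ↪ V} {N : Finset (Sym2 W)} :
    IsMatchingSet (G.comap f) N ↔ IsMatchingSet G (N.image (Sym2.map f)) := by
  have hinj := Sym2.map.injective f.injective
  simp only [IsMatchingSet, Finset.forall_mem_image, mem_edgeSet_comap, hinj.ne_iff]
  refine and_congr_right fun _ => forall₂_congr fun e he => forall₂_congr fun g hg =>
    forall_congr' fun _ => ?_
  simp only [Sym2.mem_map]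
  constructor
  · rintro h _ ⟨x, hx, rfl⟩ ⟨y, hy, hxy⟩
    exact h x hx (f.injective hxy ▸ hy)
  · exact fun h x hx hx' => h (f x) ⟨x, hx, rfl⟩ ⟨x, hx', rfl⟩

lemma exists_image_eq {G : SimpleGraph V} {f : W ↪ V}
    (hf : ∀ e ∈ G.edgeSet, ∃ e', Sym2.map f e' = e) {N : Finset (Sym2 V)}
    (hN : ∀ e ∈ N, e ∈ G.edgeSet) : ∃ N' : Finset (Sym2 W), N'.image (Sym2.map f) = N := by
  refine ⟨Finset.univ.filter fun e => Sym2.map f e ∈ N, ?_⟩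
  ext e
  simp only [Finset.mem_image, Finset.mem_filter, Finset.mem_univ, true_and]
  constructor
  · rintro ⟨e', h, rfl⟩
    exact h
  · intro he
    obtain ⟨e', rfl⟩ := hf e (hN e he)
    exact ⟨e', he, rfl⟩

lemma matchingsWith_map {G : SimpleGraph V} {f : W ↪ V}
    (hf : ∀ e ∈ G.edgeSet, ∃ e', Sym2.map f e' = e) (i : Sym2 W) :
    matchingsWith G (Sym2.map f i) =
      (matchingsWith (G.comap f) i).image (Finset.image (Sym2.map f)) := by
  have hinj := Sym2.map.injective f.injective
  ext N
  simp only [mem_matchingsWith, Finset.mem_image (s := matchingsWith _ _)]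
  constructor
  · rintro ⟨h1, h2⟩
    obtain ⟨N', rfl⟩ := exists_image_eq hf fun e he => h2.1 e (Finset.mem_insert_of_mem he)
    refine ⟨N', ⟨fun h => h1 (Finset.mem_image_of_mem _ h), ?_⟩, rfl⟩
    rwa [isMatchingSet_comap, Finset.image_insert]
  · rintro ⟨N', ⟨h1, h2⟩, rfl⟩
    rw [isMatchingSet_comap, Finset.image_insert] at h2
    exact ⟨fun h => h1 (hinj.mem_finset_image.1 h), h2⟩

lemma matchingsWithout_map {G : SimpleGraph V} {f : W ↪ V}
    (hf : ∀ e ∈ G.edgeSet, ∃ e', Sym2.map f e' = e) (i : Sym2 W) :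
    matchingsWithout G (Sym2.map f i) =
      (matchingsWithout (G.comap f) i).image (Finset.image (Sym2.map f)) := by
  have hinj := Sym2.map.injective f.injective
  ext N
  simp only [mem_matchingsWithout, Finset.mem_image (s := matchingsWithout _ _)]
  constructor
  · rintro ⟨h1, h2⟩
    obtain ⟨N', rfl⟩ := exists_image_eq hf h2.1
    exact ⟨N', ⟨fun h => h1 (Finset.mem_image_of_mem _ h), isMatchingSet_comap.2 h2⟩, rfl⟩
  · rintro ⟨N', ⟨h1, h2⟩, rfl⟩
    exact ⟨fun h => h1 (hinj.mem_finset_image.1 h), isMatchingSet_comap.1 h2⟩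

lemma HasCouplingLE.of_comap {G : SimpleGraph V} {f : W ↪ V} {lam c : ℝ} (hlam : 0 < lam)
    (hf : ∀ e ∈ G.edgeSet, ∃ e', Sym2.map f e' = e) {i : Sym2 W} (hi : Sym2.map f i ∈ G.edgeSet)
    (h : HasCouplingLE (fun M M' => (edist M M' : ℝ)) (law lam (matchingsWith (G.comap f) i))
      (law lam (matchingsWithout (G.comap f) i)) c) :
    HasCouplingLE (fun M M' => (edist M M' : ℝ)) (law lam (matchingsWith G (Sym2.map f i)))
      (law lam (matchingsWithout G (Sym2.map f i))) c := by
  have hinj := Sym2.map.injective f.injective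
  have h' := h.map (d' := fun M M' => (edist M M' : ℝ)) (Finset.image (Sym2.map f))
    (Finset.image (Sym2.map f)) (k := 0) (fun a b => by rw [edist_image hinj, add_zero])
    (sum_law hlam (matchingsWith_nonempty ((mem_edgeSet_comap G f i).2 hi)))
  rw [pushforward_law _ _ (Finset.image_injective hinj).injOn
      fun N _ => Finset.card_image_of_injective N hinj,
    pushforward_law _ _ (Finset.image_injective hinj).injOn
      fun N _ => Finset.card_image_of_injective N hinj,
    ← matchingsWith_map hf, ← matchingsWithout_map hf, zero_mul, add_zero] at h'
  exact h'

lemma exists_embedding_of_card_edges_le {G : SimpleGraph V} {s : ℕ} (hG : (edges G).card ≤ s)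
    (hs : 2 * s ≤ Fintype.card V) :
    ∃ f : Fin (2 * s) ↪ V, ∀ e ∈ G.edgeSet, ∃ e', Sym2.map f e' = e := by
  have hS : ((edges G).biUnion Sym2.toFinset).card ≤ 2 * s := by
    refine (Finset.card_biUnion_le_card_mul _ _ 2 fun e _ => ?_).trans (by omega)
    rw [Sym2.card_toFinset]
    split_ifs <;> omega
  obtain ⟨T, hST, hT⟩ := Finset.exists_superset_card_eq hS hs
  refine ⟨(T.equivFinOfCardEq hT).symm.toEmbedding.trans (Function.Embedding.subtype _), ?_⟩
  have hx : ∀ e ∈ G.edgeSet, ∀ x ∈ e, ∃ y,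
      ((T.equivFinOfCardEq hT).symm.toEmbedding.trans (Function.Embedding.subtype _)) y = x := by
    intro e he x hx
    have hxT : x ∈ T := hST (Finset.mem_biUnion.2 ⟨e, by simpa [edges] using he, by simpa using hx⟩)
    exact ⟨T.equivFinOfCardEq hT ⟨x, hxT⟩, by simp⟩
  intro e he
  induction e with | _ x y =>
  obtain ⟨x', hx'⟩ := hx _ he x (Sym2.mem_mk_left x y)
  obtain ⟨y', hy'⟩ := hx _ he y (Sym2.mem_mk_right x y)
  exact ⟨s(x', y'), by rw [Sym2.map_mk, hx', hy']⟩

lemma card_edges_comap_le (G : SimpleGraph V) (f : W ↪ V) :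
    (edges (G.comap f)).card ≤ (edges G).card := by
  refine Finset.card_le_card_of_injOn (Sym2.map f) (fun e he => ?_)
    (Sym2.map.injective f.injective).injOn
  simpa [edges, mem_edgeSet_comap] using he

lemma degr_comap_le (G : SimpleGraph V) (f : W ↪ V) (x : W) :
    degr (G.comap f) x ≤ degr G (f x) :=
  Finset.card_le_card_of_injOn f (fun y hy => by simpa using hy) f.injective.injOn

end Transport

lemma degr_mono {G H : SimpleGraph V} (h : G ≤ H) (x : V) : degr G x ≤ degr H x :=
  Finset.card_le_card fun y hy => by
    simp only [Finset.mem_filter, Finset.mem_univ, true_and] at hy ⊢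
    exact h hy

lemma degr_eq_one_iff {G : SimpleGraph V} {u v : V} (huv : G.Adj u v) :
    degr G u = 1 ↔ ∀ x, G.Adj u x → x = v := by
  unfold degr
  rw [Finset.card_eq_one]
  constructor
  · rintro ⟨a, ha⟩ x hx
    have h1 : x ∈ ({a} : Finset V) := ha ▸ by simpa using hx
    have h2 : v ∈ ({a} : Finset V) := ha ▸ by simpa using huv
    rw [Finset.mem_singleton.1 h1, Finset.mem_singleton.1 h2]
  · intro h
    refine ⟨v, Finset.ext fun x => ?_⟩
    simp only [Finset.mem_filter, Finset.mem_univ, true_and, Finset.mem_singleton]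
    exact ⟨h x, fun hx => hx ▸ huv⟩

lemma kappaE_nonneg (s Δ : ℕ) (lam : ℝ) : 0 ≤ kappaE s Δ lam := by
  refine Real.sSup_nonneg ?_
  rintro _ ⟨G, i, -, -, -, -, rfl⟩
  exact wass_nonneg fun _ _ => Nat.cast_nonneg _

lemma wass_le_kappaE {s Δ : ℕ} {lam : ℝ} {G : SimpleGraph (Fin (2 * s))} {i : Sym2 (Fin (2 * s))}
    (hG : (edges G).card ≤ s) (hdeg : ∀ v, degr G v ≤ Δ) (hi : i ∈ G.edgeSet)
    (hp : ∃ u, u ∈ i ∧ degr G u = 1) :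
    wass (fun M M' => (edist M M' : ℝ)) (condDistMap G lam (fun M => i ∈ M) (fun M => M.erase i))
      (condDist G lam (fun M => i ∉ M)) ≤ kappaE s Δ lam := by
  refine le_csSup (Set.Finite.bddAbove ?_) ⟨G, i, hG, hdeg, hi, hp, rfl⟩
  refine (Set.finite_range fun p : SimpleGraph (Fin (2 * s)) × Sym2 (Fin (2 * s)) =>
    wass (fun M M' => (edist M M' : ℝ))
      (condDistMap p.1 lam (fun M => p.2 ∈ M) (fun M => M.erase p.2))
      (condDist p.1 lam (fun M => p.2 ∉ M))).subset ?_
  rintro _ ⟨G, i, -, -, -, -, rfl⟩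
  exact ⟨(G, i), rfl⟩

lemma hasCouplingLE_of_wass_condDist_lt {G : SimpleGraph V} {i : Sym2 V} {lam c : ℝ}
    (hlam : 0 < lam) (hi : i ∈ G.edgeSet)
    (h : wass (fun M M' => (edist M M' : ℝ))
      (condDistMap G lam (fun M => i ∈ M) (fun M => M.erase i))
      (condDist G lam (fun M => i ∉ M)) < c) :
    HasCouplingLE (fun M M' => (edist M M' : ℝ)) (law lam (matchingsWith G i))
      (law lam (matchingsWithout G i)) c := by
  rw [condDistMap_erase_eq_law _ hlam, condDist_eq_law] at h
  exact HasCouplingLE.of_wass_lt (law_nonneg hlam (matchingsWith G i))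
    (law_nonneg hlam (matchingsWithout G i)) (sum_law hlam (matchingsWith_nonempty hi))
    (sum_law hlam (matchingsWithout_nonempty G i)) h

lemma hasCouplingLE_of_kappaE_lt {G : SimpleGraph V} {u v : V} {s Δ : ℕ} {lam c : ℝ}
    (hlam : 0 < lam) (hG : (edges G).card ≤ s) (hs : 2 * s ≤ Fintype.card V)
    (hdeg : ∀ x, degr G x ≤ Δ) (huv : G.Adj u v) (hu : ∀ x, G.Adj u x → x = v)
    (hc : kappaE s Δ lam < c) :
    HasCouplingLE (fun M M' => (edist M M' : ℝ)) (law lam (matchingsWith G s(u, v)))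
      (law lam (matchingsWithout G s(u, v))) c := by
  obtain ⟨f, hf⟩ := exists_embedding_of_card_edges_le hG hs
  obtain ⟨i, hi⟩ := hf s(u, v) huv
  induction i with | _ u' v' =>
  wlog h : f u' = u ∧ f v' = v generalizing u' v'
  · refine this v' u' (Sym2.eq_swap ▸ hi) ?_
    rw [Sym2.map_mk, Sym2.eq_iff] at hi
    tauto
  obtain ⟨rfl, rfl⟩ := h
  have hmem : s(u', v') ∈ (G.comap f).edgeSet := huv
  have hwass := (wass_le_kappaE (lam := lam) ((card_edges_comap_le G f).trans hG)
    (fun x => (degr_comap_le G f x).trans (hdeg _)) hmem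
    ⟨u', Sym2.mem_mk_left u' v', (degr_eq_one_iff (v := v') huv).2
      fun x hx => f.injective (hu _ hx)⟩).trans_lt hc
  have h := HasCouplingLE.of_comap hlam hf ((mem_edgeSet_comap G f _).1 hmem)
    (hasCouplingLE_of_wass_condDist_lt hlam hmem hwass)
  rwa [Sym2.map_mk] at h

lemma card_edges_isolateExcept_lt {G : SimpleGraph V} {u v w : V} (huv : G.Adj u v)
    (hwu : w ≠ u) : (edges (isolateExcept G v w)).card < (edges G).card := by
  refine Finset.card_lt_card (Finset.ssubset_iff_of_subset (fun e he => ?_) |>.2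
    ⟨s(u, v), by simpa [edges] using huv, fun h => ?_⟩)
  · simp only [edges, Finset.mem_filter, Finset.mem_univ, true_and] at he ⊢
    exact (mem_edgeSet_isolateExcept.1 he).1
  · simp only [edges, Finset.mem_filter, Finset.mem_univ, true_and] at h
    rcases (mem_edgeSet_isolateExcept.1 h).2 with h | h
    · rw [Sym2.eq_swap] at h
      exact hwu (Sym2.congr_right.1 h).symm
    · exact h (Sym2.mem_mk_right u v)

/-- the recursion `κ^E_{s+1,Δ,λ} ≤ (λΔ/(1+λΔ))·(κ^E_{s,Δ,λ} + 1)`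
for every `s ≥ 1`. -/
theorem stmt_19 (s Δ : ℕ) (hs : 1 ≤ s) (hΔ : 1 ≤ Δ) (lam : ℝ) (hlam : 0 < lam) :
    kappaE (s + 1) Δ lam ≤
      lam * (Δ : ℝ) / (1 + lam * (Δ : ℝ)) * (kappaE s Δ lam + 1) := by
  refine Real.sSup_le ?_ (mul_nonneg (by positivity) (by linarith [kappaE_nonneg s Δ lam]))
  rintro _ ⟨G, i, hG, hdeg, hi, ⟨u, hui, hu⟩, rfl⟩
  obtain ⟨v, rfl⟩ := Sym2.mem_iff_exists.1 hui
  have huv : G.Adj u v := hi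
  rw [degr_eq_one_iff huv] at hu
  rw [condDistMap_erase_eq_law _ hlam, condDist_eq_law]
  have hpos : 0 < lam * (Δ : ℝ) / (1 + lam * (Δ : ℝ)) := by positivity
  rw [← div_le_iff₀' hpos, ← sub_le_iff_le_add]
  refine le_of_forall_gt_imp_ge_of_dense fun c hc => ?_
  rw [sub_le_iff_le_add, div_le_iff₀' hpos]
  refine (hasCouplingLE_of_isolateExcept hlam ((kappaE_nonneg s Δ lam).trans hc.le) huv hu
    (hdeg v) fun w hvw hwu => ?_).wass_le fun _ _ => Nat.cast_nonneg _
  have hcard := card_edges_isolateExcept_lt huv hwu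
  exact hasCouplingLE_of_kappaE_lt hlam (by omega) (by rw [Fintype.card_fin]; omega)
    (fun x => (degr_mono (isolateExcept_le G v w) x).trans (hdeg x)) (isolateExcept_adj hvw)
    (fun x hx => eq_of_isolateExcept_adj hx) hc

end SensMatching
end
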